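/- arXiv:0711.3013 — 8 statements merged into one kernel-verified Lean document; each statement's English description precedes it below -/
import Mathlib

section
/- Let G be a d-uniform hypergraph with n vertices and m = k·n hyperedges, where k, d ≥ 1. Then G is (k,0)-tight if and only if G admits an orientation in which every vertex is the tail of exactly k hyperedges. -/
/-- Hall's theorem with capacities: a family of finite sets has a choice function taking each
value at most `k` times, provided every set `V'` contains at most `k * |V'|` of its members. -/
theorem exists_choice_card_fiber_le {ι α : Type*} [Fintype ι] [DecidableEq α]
    (k : ℕ) (ends : ι → Finset α)
    (h : ∀ V' : Finset α, (Finset.univ.filter fun e => ends e ⊆ V').card ≤ k * V'.card) :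
    ∃ t : ι → α, (∀ e, t e ∈ ends e) ∧
      ∀ v, (Finset.univ.filter fun e => t e = v).card ≤ k := by
  obtain ⟨f, hf, hmem⟩ := (Finset.all_card_le_biUnion_card_iff_exists_injective
    fun e => ends e ×ˢ (Finset.univ : Finset (Fin k))).mp fun s => by
      have hprod : s.biUnion (fun e => ends e ×ˢ (Finset.univ : Finset (Fin k)))
          = s.biUnion ends ×ˢ Finset.univ := by
        ext x
        simp
      rw [hprod, Finset.card_product, Finset.card_fin, mul_comm]
      refine le_trans (Finset.card_le_card fun e he => ?_) (h (s.biUnion ends))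
      simpa using Finset.subset_biUnion_of_mem ends he
  refine ⟨fun e => (f e).1, fun e => (Finset.mem_product.mp (hmem e)).1, fun v => ?_⟩
  calc (Finset.univ.filter fun e => (f e).1 = v).card
      ≤ (Finset.univ : Finset (Fin k)).card := by
        refine Finset.card_le_card_of_injOn (fun e => (f e).2) (by simp) fun a ha b hb hab => ?_
        simp only [Finset.coe_filter, Finset.mem_univ, true_and, Set.mem_ofPred_eq] at ha hb
        exact hf (Prod.ext (ha.trans hb.symm) hab)
    _ = k := Finset.card_fin k


/-- Let `G` be a `d`-uniform hypergraph with `n` vertices and `m = k*n`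
hyperedges, where `k, d ≥ 1`.  Then `G` is `(k, 0)`-tight if and only if `G` admits an
orientation (an assignment of a tail `t e ∈ ends e` to each hyperedge `e`) in which every
vertex is the tail of exactly `k` hyperedges. -/
theorem tight_iff_orientation (k d n m : ℕ) (hk : 1 ≤ k) (hd : 1 ≤ d)
    (hm : m = k * n)
    (ends : Fin m → Finset (Fin n)) (hunif : ∀ e, (ends e).card = d) :
    ((∀ V' : Finset (Fin n),
        (Finset.univ.filter fun e => ends e ⊆ V').card ≤ k * V'.card) ∧ m = k * n)
    ↔ ∃ t : Fin m → Fin n, (∀ e, t e ∈ ends e) ∧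
        ∀ v : Fin n, (Finset.univ.filter fun e => t e = v).card = k := by
  constructor
  · rintro ⟨h, -⟩
    obtain ⟨t, ht, hle⟩ := exists_choice_card_fiber_le k ends h
    refine ⟨t, ht, fun v => ?_⟩
    have hsum : ∑ v, (Finset.univ.filter fun e => t e = v).card = ∑ _v : Fin n, k := by
      rw [← Finset.card_eq_sum_card_fiberwise (fun _ _ => Finset.mem_coe.mpr (Finset.mem_univ _))]
      simp [hm, mul_comm]
    exact (Finset.sum_eq_sum_iff_of_le fun v _ => hle v).mp hsum v (Finset.mem_univ v)
  · rintro ⟨t, ht, hcard⟩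
    refine ⟨fun V' => ?_, hm⟩
    rw [mul_comm]
    calc (Finset.univ.filter fun e => ends e ⊆ V').card
        ≤ (V'.biUnion fun v => Finset.univ.filter fun e => t e = v).card :=
          Finset.card_le_card fun e he => by
            simpa using (Finset.mem_filter.mp he).2 (ht e)
      _ ≤ V'.card * k := Finset.card_biUnion_le_card_mul _ _ _ fun v _ => (hcard v).le
end

section
/- Let k, d ≥ 1 and let G be a d-uniform hypergraph with n vertices and m = k·n hyperedges. Then the generic natural matrix M_{k,0,d}(G) has rank k·n over the field ℝ(a^j_{e_i}) of rational functions in its entry indeterminates if and only if G is (k,0)-tight. -/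
/-- Index type for the generic entry indeterminates `a^j_{e_i}` of the natural matrix:
one for each hyperedge `e`, each endpoint of `e`, and each `j ∈ Fin k`. -/
def GenVars (n k : ℕ) {ι : Type} (ends : ι → Finset (Fin n)) : Type :=
  Σ e : ι, {v : Fin n // v ∈ ends e} × Fin k

/-- The generic natural matrix `M_{k,0,d}(G)` of the hypergraph with edge set `ι` and
endpoint map `ends`, over the field of real rational functions in the indeterminates
`a^j_{e_i}`: the row of `e` has the entries `a^1_{e_i}, …, a^k_{e_i}` in the block
of `k` columns of each endpoint `e_i` of `e`, and zeros in all other columns. -/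
noncomputable def genericNaturalMatrix (n k : ℕ) {ι : Type} (ends : ι → Finset (Fin n)) :
    Matrix ι (Fin n × Fin k) (FractionRing (MvPolynomial (GenVars n k ends) ℝ)) :=
  Matrix.of fun e p =>
    if h : p.1 ∈ ends e then
      algebraMap (MvPolynomial (GenVars n k ends) ℝ) _
        (MvPolynomial.X (⟨e, ⟨p.1, h⟩, p.2⟩ : GenVars n k ends))
    else 0

/-- The generic natural matrix has full row rank when its hyperedges can be matched
injectively with the columns supporting their rows. -/
theorem genericNaturalMatrix_rank_of_matching {n k m : ℕ} (ends : Fin m → Finset (Fin n))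
    (σ : Fin m ≃ Fin n × Fin k) (hσ : ∀ e, (σ e).1 ∈ ends e) :
    (genericNaturalMatrix n k ends).rank = m := by
  classical
  let R := MvPolynomial (GenVars n k ends) ℝ
  let B : Matrix (Fin m) (Fin m) R := Matrix.of fun e e' =>
    if h : (σ e').1 ∈ ends e then
      MvPolynomial.X (⟨e, ⟨(σ e').1, h⟩, (σ e').2⟩ : GenVars n k ends)
    else 0
  let x : GenVars n k ends → ℝ := fun y => if σ y.1 = (y.2.1.1, y.2.2) then 1 else 0
  have hx : (MvPolynomial.eval x).mapMatrix B = 1 := by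
    ext e e'
    rcases eq_or_ne e e' with rfl | hne
    · have hB : B e e = MvPolynomial.X (⟨e, ⟨(σ e).1, hσ e⟩, (σ e).2⟩ : GenVars n k ends) :=
        dif_pos (hσ e)
      rw [RingHom.mapMatrix_apply, Matrix.map_apply, hB, Matrix.one_apply_eq]
      exact (MvPolynomial.eval_X _).trans (if_pos rfl)
    · rw [RingHom.mapMatrix_apply, Matrix.map_apply, Matrix.one_apply_ne hne]
      by_cases h : (σ e').1 ∈ ends e
      · have hB : B e e' = MvPolynomial.X (⟨e, ⟨(σ e').1, h⟩, (σ e').2⟩ : GenVars n k ends) :=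
          dif_pos h
        rw [hB]
        exact (MvPolynomial.eval_X _).trans (if_neg (σ.injective.ne hne))
      · have hB : B e e' = 0 := dif_neg h
        rw [hB, map_zero]
  have hB : B.det ≠ 0 := by
    intro h
    have h1 := (MvPolynomial.eval x).map_det B
    rw [hx, h] at h1
    simp at h1
  have hA : (genericNaturalMatrix n k ends).submatrix (Equiv.refl _) σ =
      (algebraMap R (FractionRing R)).mapMatrix B := by
    ext e e'
    by_cases h : (σ e').1 ∈ ends e <;> simp [B, genericNaturalMatrix, h, R]
  have hdet : ((genericNaturalMatrix n k ends).submatrix (Equiv.refl _) σ).det ≠ 0 := by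
    rw [hA, ← RingHom.map_det]
    exact (map_ne_zero_iff _ (IsFractionRing.injective R (FractionRing R))).2 hB
  rw [← Matrix.rank_submatrix _ (Equiv.refl _) σ, Matrix.rank_of_det_ne_zero hdet,
    Fintype.card_fin]

/-- If the rows of the generic natural matrix are linearly independent, then every vertex set
`V'` induces at most `k * |V'|` hyperedges. -/
theorem card_induced_le_of_linearIndependent_row {n k m : ℕ} (ends : Fin m → Finset (Fin n))
    (h : LinearIndependent (FractionRing (MvPolynomial (GenVars n k ends) ℝ))
      (genericNaturalMatrix n k ends).row) (V' : Finset (Fin n)) :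
    (Finset.univ.filter fun e => ends e ⊆ V').card ≤ k * V'.card := by
  classical
  let S := Finset.univ.filter fun e => ends e ⊆ V'
  let C := (genericNaturalMatrix n k ends).submatrix (Subtype.val : S → Fin m) id
  have hC : C.rank = S.card := by
    have hrow : LinearIndependent _ C.row := h.comp Subtype.val Subtype.val_injective
    simpa using hrow.rank_matrix
  have hle : C.transpose.rank ≤ (V' ×ˢ (Finset.univ : Finset (Fin k))).card := by
    refine Matrix.rank_le_card_of_support_subset _ _ (Function.support_subset_iff'.2 fun p hp => ?_)
    ext e
    refine dif_neg fun hmem => hp ?_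
    exact Finset.mem_coe.2 (Finset.mem_product.2
      ⟨(Finset.mem_filter.1 e.2).2 hmem, Finset.mem_univ _⟩)
  rwa [Matrix.rank_transpose, hC, Finset.card_product, Finset.card_univ, Fintype.card_fin,
    mul_comm] at hle

/-- Hall's theorem for a sparse hypergraph: every hyperedge can be assigned one of `k` copies of
one of its endpoints, all distinct. -/
theorem exists_injective_matching_of_sparse {n k m : ℕ} (ends : Fin m → Finset (Fin n))
    (h : ∀ V' : Finset (Fin n),
      (Finset.univ.filter fun e => ends e ⊆ V').card ≤ k * V'.card) :
    ∃ f : Fin m → Fin n × Fin k, Function.Injective f ∧ ∀ e, (f e).1 ∈ ends e := by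
  classical
  obtain ⟨f, hf, hmem⟩ := (Finset.all_card_le_biUnion_card_iff_exists_injective
    fun e => ends e ×ˢ (Finset.univ : Finset (Fin k))).1 fun S => by
      have hU : (S.biUnion fun e => ends e ×ˢ (Finset.univ : Finset (Fin k))) =
          S.biUnion ends ×ˢ Finset.univ := by
        ext p
        simp
      rw [hU, Finset.card_product, Finset.card_univ, Fintype.card_fin, mul_comm]
      refine le_trans (Finset.card_le_card fun e he => ?_) (h (S.biUnion ends))
      simpa using Finset.subset_biUnion_of_mem ends he
  exact ⟨f, hf, fun e => (Finset.mem_product.1 (hmem e)).1⟩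

/-- Let `k, d ≥ 1` and let `G` be a `d`-uniform hypergraph with `n` vertices
and `m = k*n` hyperedges.  Then the generic natural matrix `M_{k,0,d}(G)` has rank `k*n`
over the field of rational functions in its entry indeterminates if and only if `G` is
`(k, 0)`-tight. -/
theorem generic_matrix_full_rank_iff_tight (k d n m : ℕ) (hk : 1 ≤ k) (hd : 1 ≤ d)
    (hm : m = k * n)
    (ends : Fin m → Finset (Fin n)) (hunif : ∀ e, (ends e).card = d) :
    (genericNaturalMatrix n k ends).rank = k * n ↔
      ((∀ V' : Finset (Fin n),
          (Finset.univ.filter fun e => ends e ⊆ V').card ≤ k * V'.card) ∧ m = k * n) := by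
  refine ⟨fun h => ⟨card_induced_le_of_linearIndependent_row ends ?_, hm⟩, fun h => ?_⟩
  · rw [linearIndependent_iff_card_eq_finrank_span, Set.finrank,
      ← Matrix.rank_eq_finrank_span_row, h, Fintype.card_fin, hm]
  · obtain ⟨f, hf, hmem⟩ := exists_injective_matching_of_sparse ends h.1
    have hbij : Function.Bijective f :=
      (Fintype.bijective_iff_injective_and_card f).2 ⟨hf, by simp [hm, mul_comm]⟩
    rw [← hm]
    exact genericNaturalMatrix_rank_of_matching ends (Equiv.ofBijective f hbij) hmem
end

section
/- Let k, d ≥ 1 and let G be a d-uniform hypergraph with n vertices and m = k·n hyperedges. Then G is (k,0)-tight if and only if there exists a natural matrix for G (with real entries) whose rank is k·n. -/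
open Finset in
/-- If the matrix rows with indices in `S` are linearly independent and vanish outside the column
set `T`, then `S` has at most as many elements as `T`. -/
theorem card_le_card_of_linearIndependent_of_support {R ι κ : Type*} [Field R]
    (M : Matrix ι κ R) (hM : LinearIndependent R M.row) (S : Finset ι) (T : Finset κ)
    (hsupp : ∀ e ∈ S, ∀ p, p ∉ T → M e p = 0) : #S ≤ #T := by
  classical
  let L : (T → R) →ₗ[R] (κ → R) :=
    LinearMap.pi fun p => if h : p ∈ T then LinearMap.proj ⟨p, h⟩ else 0
  let N : S → T → R := fun e p => M e p
  have hcomp : L ∘ N = fun e : S => M.row e := by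
    funext e p
    by_cases h : p ∈ T
    · simp [L, N, h]
    · simp [L, h, hsupp e e.2 p h]
  have hN : LinearIndependent R N := by
    apply LinearIndependent.of_comp L
    rw [hcomp]
    exact hM.comp _ Subtype.val_injective
  simpa using hN.fintype_card_le_finrank

/-- The rows of a matrix whose rank is the number of rows are linearly independent. -/
theorem linearIndependent_row_of_rank_eq_card {R ι κ : Type*} [Field R] [Fintype ι] [Fintype κ]
    (M : Matrix ι κ R) (hM : M.rank = Fintype.card ι) : LinearIndependent R M.row := by
  rw [linearIndependent_iff_card_eq_finrank_span, ← hM, Matrix.rank_eq_finrank_span_row]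
  rfl

open Finset in
/-- A `(k, 0)`-sparse hypergraph admits an injective assignment of its hyperedges to
(endpoint, color) pairs with `k` colors. -/
theorem exists_injective_of_sparse {ι V : Type*} [Fintype ι] [DecidableEq V] (k : ℕ)
    (ends : ι → Finset V)
    (h : ∀ V' : Finset V, #{e | ends e ⊆ V'} ≤ k * #V') :
    ∃ f : ι → V × Fin k, Function.Injective f ∧ ∀ e, (f e).1 ∈ ends e := by
  classical
  obtain ⟨f, hf, hmem⟩ := (Finset.all_card_le_biUnion_card_iff_exists_injective
    fun e => ends e ×ˢ (univ : Finset (Fin k))).1 fun s => by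
      have hprod : s.biUnion (fun e => ends e ×ˢ (univ : Finset (Fin k)))
          = s.biUnion ends ×ˢ univ := by
        ext ⟨v, j⟩
        simp
      calc #s ≤ #{e | ends e ⊆ s.biUnion ends} := card_le_card fun e he => by
              simpa using subset_biUnion_of_mem ends he
        _ ≤ k * #(s.biUnion ends) := h _
        _ = _ := by rw [hprod, card_product, card_univ, Fintype.card_fin, mul_comm]
  exact ⟨f, hf, fun e => by simpa [Finset.mem_product] using hmem e⟩


/-- Let `k, d ≥ 1` and let `G` be a `d`-uniform hypergraph with `n` vertices
and `m = k*n` hyperedges.  Then `G` is `(k, 0)`-tight if and only if there exists a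
natural matrix for `G` with real entries (one row per hyperedge, `k` columns per vertex,
with zeros in the row of `e` outside the column blocks of the endpoints of `e`) whose
rank is `k*n`. -/
theorem tight_iff_exists_natural_matrix_full_rank (k d n m : ℕ) (hk : 1 ≤ k) (hd : 1 ≤ d)
    (hm : m = k * n)
    (ends : Fin m → Finset (Fin n)) (hunif : ∀ e, (ends e).card = d) :
    ((∀ V' : Finset (Fin n),
        (Finset.univ.filter fun e => ends e ⊆ V').card ≤ k * V'.card) ∧ m = k * n)
    ↔ ∃ M : Matrix (Fin m) (Fin n × Fin k) ℝ,
        (∀ e v j, v ∉ ends e → M e (v, j) = 0) ∧ M.rank = k * n := by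
  constructor
  · rintro ⟨hsparse, -⟩
    obtain ⟨f, hf, hmem⟩ := exists_injective_of_sparse k ends hsparse
    refine ⟨Matrix.of fun e => Pi.single (f e) 1, fun e v j hv => ?_, ?_⟩
    · refine Pi.single_eq_of_ne (fun h => hv ?_) _
      simpa [← h] using hmem e
    · have hrow : LinearIndependent ℝ
          (Matrix.of fun e => (Pi.single (f e) 1 : Fin n × Fin k → ℝ)).row := by
        convert (Pi.basisFun ℝ (Fin n × Fin k)).linearIndependent.comp f hf using 1
        funext e
        exact (Pi.basisFun_apply ℝ _ (f e)).symm
      rw [hrow.rank_matrix, Fintype.card_fin, hm]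
  · rintro ⟨M, hM, hrank⟩
    refine ⟨fun V' => ?_, hm⟩
    have hrow := linearIndependent_row_of_rank_eq_card M (by rw [hrank, Fintype.card_fin, hm])
    have hcard := card_le_card_of_linearIndependent_of_support M hrow
      (Finset.univ.filter fun e => ends e ⊆ V') (V' ×ˢ Finset.univ) fun e he p hp =>
        hM e p.1 p.2 fun hv => hp <| by simpa using (Finset.mem_filter.1 he).2 hv
    simpa [mul_comm] using hcard
end

section
/- Let k, d ≥ 1 and let n be sufficiently large. The generic natural matrix M_{k,0,d}(K^{dk}_{n,d}) is a generic representation of the (k,0,d)-sparsity matroid; in particular, for every sub-multiset S of hyperedges of K^{dk}_{n,d} with |S| = k·n, the rows of M_{k,0,d}(K^{dk}_{n,d}) indexed by S are linearly independent over the rational function field if and only if the hypergraph (V,S) is (k,0)-tight. -/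
/-- The hyperedge type of the complete `d`-uniform hypergraph on `n` vertices with each
hyperedge of multiplicity `μ`. -/
def CompleteEdge (n d μ : ℕ) : Type := {s : Finset (Fin n) // s.card = d} × Fin μ

section GenericMatrix

variable {n k : ℕ} {ι : Type} (ends : ι → Finset (Fin n))

/-- If the rows of the generic natural matrix indexed by `S` are independent, then every vertex
set `V'` induces at most `k * |V'|` hyperedges of `S`, because the rows of these hyperedges are
supported on the columns of `V'`. -/
theorem card_filter_subset_le_of_linearIndependent (S : Finset ι)
    (h : LinearIndependent (FractionRing (MvPolynomial (GenVars n k ends) ℝ))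
      (fun e : {x // x ∈ S} => genericNaturalMatrix n k ends e.1)) (V' : Finset (Fin n)) :
    (S.filter fun e => ends e ⊆ V').card ≤ k * V'.card := by
  let K := FractionRing (MvPolynomial (GenVars n k ends) ℝ)
  let T := S.filter fun e => ends e ⊆ V'
  let g : {v // v ∈ V'} × Fin k → Fin n × Fin k := fun p => (p.1.1, p.2)
  have hg : Function.Injective g := by
    rintro ⟨⟨a, ha⟩, i⟩ ⟨⟨b, hb⟩, j⟩ hab
    simpa [g] using hab
  have hT : LinearIndependent K (fun e : {x // x ∈ T} => genericNaturalMatrix n k ends e.1) :=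
    h.comp (fun e : {x // x ∈ T} => ⟨e.1, (Finset.mem_filter.1 e.2).1⟩)
      (fun a b hab => Subtype.ext (congrArg (fun x : {x // x ∈ S} => x.1) hab))
  have hr : LinearIndependent K
      (fun (e : {x // x ∈ T}) p => genericNaturalMatrix n k ends e.1 (g p)) := by
    refine LinearIndependent.of_comp (Function.ExtendByZero.linearMap K g) ?_
    convert hT using 1
    funext e p
    simp only [Function.comp_apply, Function.ExtendByZero.linearMap_apply]
    by_cases hp : p.1 ∈ V'
    · exact hg.extend_apply (fun q => genericNaturalMatrix n k ends e.1 (g q)) 0 (⟨p.1, hp⟩, p.2)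
    · rw [Function.extend_apply']
      · have : p.1 ∉ ends e.1 := fun hm => hp ((Finset.mem_filter.1 e.2).2 hm)
        simp [genericNaturalMatrix, this]
      · rintro ⟨q, rfl⟩
        exact hp q.1.2
  have hcard := hr.fintype_card_le_finrank.trans (Module.finrank_fintype_fun_eq_card K).le
  simpa [T, mul_comm] using hcard

/-- If every vertex set `V'` induces at most `k * |V'|` hyperedges of `S`, then the hyperedges
can be assigned injectively to pairs of an endpoint and an element of `Fin k`. -/
theorem exists_injective_mem_of_card_filter_subset_le (S : Finset ι)
    (h : ∀ V' : Finset (Fin n), (S.filter fun e => ends e ⊆ V').card ≤ k * V'.card) :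
    ∃ f : {x // x ∈ S} → Fin n × Fin k, Function.Injective f ∧ ∀ e, (f e).1 ∈ ends e.1 := by
  classical
  obtain ⟨f, hf, hmem⟩ := (Finset.all_card_le_biUnion_card_iff_exists_injective
    (fun e : {x // x ∈ S} => ends e.1 ×ˢ (Finset.univ : Finset (Fin k)))).1 (by
      intro T
      have hU : T.biUnion (fun e => ends e.1 ×ˢ (Finset.univ : Finset (Fin k))) =
          (T.biUnion fun e => ends e.1) ×ˢ Finset.univ := by
        ext p
        simp
      rw [hU, Finset.card_product, Finset.card_univ, Fintype.card_fin, mul_comm,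
        ← Finset.card_map (Function.Embedding.subtype _)]
      refine (Finset.card_le_card ?_).trans (h _)
      intro e he
      obtain ⟨x, hx, rfl⟩ := Finset.mem_map.1 he
      exact Finset.mem_filter.2
        ⟨x.2, Finset.subset_biUnion_of_mem (fun e : {x // x ∈ S} => ends e.1) hx⟩)
  exact ⟨f, hf, fun e => (Finset.mem_product.1 (hmem e)).1⟩

/-- If every vertex set `V'` induces at most `k * |V'|` hyperedges of `S`, then the rows of the
generic natural matrix indexed by `S` are independent: an injective assignment of the hyperedges
to columns selects a square submatrix that specializes to the identity matrix. -/
theorem linearIndependent_of_card_filter_subset_le (S : Finset ι)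
    (h : ∀ V' : Finset (Fin n), (S.filter fun e => ends e ⊆ V').card ≤ k * V'.card) :
    LinearIndependent (FractionRing (MvPolynomial (GenVars n k ends) ℝ))
      (fun e : {x // x ∈ S} => genericNaturalMatrix n k ends e.1) := by
  classical
  obtain ⟨f, hf, hmem⟩ := exists_injective_mem_of_card_filter_subset_le ends S h
  let R := MvPolynomial (GenVars n k ends) ℝ
  let K := FractionRing R
  let B : Matrix {x // x ∈ S} {x // x ∈ S} R := Matrix.of fun e e' =>
    if hm : (f e').1 ∈ ends e.1 then
      MvPolynomial.X (⟨e.1, ⟨(f e').1, hm⟩, (f e').2⟩ : GenVars n k ends)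
    else 0
  let c : GenVars n k ends → ℝ := fun x =>
    if ∃ hx : x.1 ∈ S, f ⟨x.1, hx⟩ = (x.2.1.1, x.2.2) then 1 else 0
  have hB : B.map (MvPolynomial.eval c) = 1 := by
    ext e e'
    by_cases he : e = e'
    · subst he
      simp only [B, Matrix.map_apply, Matrix.of_apply, dif_pos (hmem e), Matrix.one_apply_eq]
      exact (MvPolynomial.eval_X _).trans (if_pos ⟨e.2, rfl⟩)
    · have hne : f e ≠ f e' := fun hfe => he (hf hfe)
      by_cases hm : (f e').1 ∈ ends e.1
      · simp only [B, Matrix.map_apply, Matrix.of_apply, dif_pos hm, Matrix.one_apply_ne he]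
        exact (MvPolynomial.eval_X _).trans (if_neg fun hx => hne hx.2)
      · simp [B, hm, he]
  have hdet : B.det ≠ 0 := by
    intro h0
    have h1 := RingHom.map_det (MvPolynomial.eval c) B
    rw [RingHom.mapMatrix_apply, hB, h0] at h1
    simp at h1
  have hdetK : (B.map (algebraMap R K)).det ≠ 0 := by
    rw [← RingHom.mapMatrix_apply, ← RingHom.map_det]
    exact (map_ne_zero_iff _ (IsFractionRing.injective R K)).2 hdet
  refine LinearIndependent.of_comp (LinearMap.funLeft K K f) ?_
  have hrow : (B.map (algebraMap R K)).row =
      LinearMap.funLeft K K f ∘ fun e : {x // x ∈ S} => genericNaturalMatrix n k ends e.1 := ?_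
  · exact hrow ▸ Matrix.linearIndependent_rows_of_det_ne_zero hdetK
  funext e e'
  by_cases hm : (f e').1 ∈ ends e.1
  · simp [B, genericNaturalMatrix, LinearMap.funLeft_apply, hm, K, R]
  · simp [B, genericNaturalMatrix, LinearMap.funLeft_apply, hm]

end GenericMatrix

/-- Let `k, d ≥ 1` and let `n` be sufficiently large.  The generic natural
matrix `M_{k,0,d}(K^{dk}_{n,d})` is a generic representation of the `(k,0,d)`-sparsity
matroid: for every sub-multiset `S` of hyperedges of `K^{dk}_{n,d}` with `|S| = k*n`, the
rows of the matrix indexed by `S` are linearly independent over the rational function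
field if and only if the hypergraph `(V, S)` is `(k, 0)`-tight. -/
theorem generic_matrix_represents_k0d_matroid (k d : ℕ) (hk : 1 ≤ k) (hd : 1 ≤ d) :
    ∃ N : ℕ, ∀ n : ℕ, N ≤ n →
      ∀ S : Finset (CompleteEdge n d (d * k)),
        S.card = k * n →
        (LinearIndependent (FractionRing (MvPolynomial
              (GenVars n k (fun e : CompleteEdge n d (d * k) => e.1.1)) ℝ))
            (fun e : {x // x ∈ S} =>
              genericNaturalMatrix n k (fun e : CompleteEdge n d (d * k) => e.1.1) e.1) ↔
          ((∀ V' : Finset (Fin n),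
              (S.filter fun e => e.1.1 ⊆ V').card ≤ k * V'.card) ∧ S.card = k * n)) := by
  exact ⟨0, fun n _ S hS =>
    ⟨fun h => ⟨card_filter_subset_le_of_linearIndependent _ S h, hS⟩,
      fun h => linearIndependent_of_card_filter_subset_le _ S h.1⟩⟩
end

section
/- Let (k,ℓ,d) be matroidal sparsity parameters and let G be a d-uniform hypergraph with n vertices and m = k·n − ℓ hyperedges that is NOT (k,ℓ)-sparse. Let U be a real (k·n) × ℓ matrix with the property that for every vertex subset V' with |V'| ≥ d, the submatrix of U consisting of the k·|V'| rows corresponding to the vertices of V' has rank ℓ. Then every natural matrix M for G satisfying M·U = 0 has linearly dependent rows, i.e., rank(M) < k·n − ℓ. -/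
/-- Linear independence of the rows of a matrix passes to a block of rows restricted to the columns
supporting them. -/
theorem Matrix.linearIndependent_row_submatrix {ι κ R : Type*} [CommSemiring R]
    {A : Matrix ι κ R} (hA : LinearIndependent R A.row) {p : ι → Prop} {q : κ → Prop}
    (hsupp : ∀ i j, p i → ¬ q j → A i j = 0) :
    LinearIndependent R
      (A.submatrix (Subtype.val : {i // p i} → ι) (Subtype.val : {j // q j} → κ)).row := by
  refine LinearIndependent.of_comp
    (Function.ExtendByZero.linearMap R (Subtype.val : {j // q j} → κ)) ?_
  convert hA.comp (Subtype.val : {i // p i} → ι) Subtype.val_injective using 1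
  ext i j
  by_cases hj : q j
  · exact Subtype.val_injective.extend_apply _ _ (⟨j, hj⟩ : {j // q j})
  · exact (Function.extend_apply' _ _ _ fun ⟨x, hx⟩ => hj (hx ▸ x.2)).trans
      (hsupp i j i.2 hj).symm

/-- A block of rows of a product can be computed from the columns supporting that block. -/
theorem Matrix.submatrix_mul_submatrix_of_support {ι κ μ R : Type*} [Fintype κ]
    [NonUnitalNonAssocSemiring R] (A : Matrix ι κ R) (B : Matrix κ μ R) {p : ι → Prop}
    {q : κ → Prop} [DecidablePred q] (hsupp : ∀ i j, p i → ¬ q j → A i j = 0) :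
    A.submatrix (Subtype.val : {i // p i} → ι) (Subtype.val : {j // q j} → κ) *
        B.submatrix (Subtype.val : {j // q j} → κ) id =
      (A * B).submatrix Subtype.val id := by
  ext i c
  simp only [Matrix.mul_apply, Matrix.submatrix_apply, id_eq]
  rw [← Fintype.sum_subtype_add_sum_subtype q fun j => A i j * B j c]
  simp [fun j : {j // ¬ q j} => hsupp i j i.2 j.2]


/-- Let `(k, ℓ, d)` be matroidal sparsity parameters and let `G` be a
`d`-uniform hypergraph with `n` vertices and `m = k*n - ℓ` hyperedges that is NOT
`(k, ℓ)`-sparse.  Let `U` be a real `(k*n) × ℓ` matrix such that for every vertex subset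
`V'` with `|V'| ≥ d`, the submatrix of `U` on the `k*|V'|` rows corresponding to the
vertices of `V'` has rank `ℓ`.  Then every natural matrix `M` for `G` with `M * U = 0`
has linearly dependent rows, i.e. `rank M < k*n - ℓ`. -/
theorem not_sparse_rank_drop (k ℓ d n m : ℕ) (hparam : ℓ < d * k)
    (hm : m + ℓ = k * n)
    (ends : Fin m → Finset (Fin n)) (hunif : ∀ e, (ends e).card = d)
    (hnotsparse : ¬ ∀ V' : Finset (Fin n),
      (Finset.univ.filter fun e => ends e ⊆ V').card ≤ k * V'.card - ℓ)
    (U : Matrix (Fin n × Fin k) (Fin ℓ) ℝ)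
    (hU : ∀ V' : Finset (Fin n), d ≤ V'.card →
      (U.submatrix (fun p : {x : Fin n × Fin k // x.1 ∈ V'} => p.1) id).rank = ℓ)
    (M : Matrix (Fin m) (Fin n × Fin k) ℝ)
    (hnat : ∀ e v j, v ∉ ends e → M e (v, j) = 0)
    (hMU : M * U = 0) :
    M.rank < k * n - ℓ := by
  by_contra hrank
  push Not at hnotsparse
  obtain ⟨V', hV'⟩ := hnotsparse
  have hcard : d ≤ V'.card := by
    obtain ⟨e, he⟩ := Finset.card_pos.mp (Nat.zero_lt_of_lt hV')
    exact hunif e ▸ Finset.card_le_card (Finset.mem_filter.mp he).2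
  have hrows : LinearIndependent ℝ M.row := by
    rw [linearIndependent_iff_card_eq_finrank_span, Set.finrank, ← Matrix.rank_eq_finrank_span_row,
      Fintype.card_fin]
    have := M.rank_le_card_height.trans_eq (Fintype.card_fin m)
    omega
  have hsupp : ∀ e (x : Fin n × Fin k), ends e ⊆ V' → x.1 ∉ V' → M e x = 0 :=
    fun e x he hx => hnat e x.1 x.2 fun hv => hx (he hv)
  have hle := Matrix.rank_add_rank_le_card_of_mul_eq_zero
    ((Matrix.submatrix_mul_submatrix_of_support M U hsupp).trans (by rw [hMU]; rfl))
  have hcols : Fintype.card {x : Fin n × Fin k // x.1 ∈ V'} = k * V'.card := by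
    rw [Fintype.card_subtype, mul_comm,
      show Finset.univ.filter (fun x : Fin n × Fin k => x.1 ∈ V') = V' ×ˢ Finset.univ by
        ext; simp,
      Finset.card_product, Finset.card_fin]
  rw [(Matrix.linearIndependent_row_submatrix hrows hsupp).rank_matrix, hU V' hcard, hcols,
    Fintype.card_subtype] at hle
  omega
end

section
/- Let (k,ℓ,d) be matroidal sparsity parameters and let G be a (k,ℓ)-tight d-uniform hypergraph on n vertices (so G has m = k·n − ℓ hyperedges). Then there exist a natural matrix M for G and a real (k·n) × ℓ matrix U of rank ℓ such that M·U = 0 and rank(M) = k·n − ℓ. -/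
/-- Selecting distinct rows of an identity matrix gives a matrix of full row rank. -/
theorem Matrix.rank_one_submatrix_of_injective {ι α : Type*} [Fintype ι] [Fintype α]
    [DecidableEq α] {f : ι → α} (hf : Function.Injective f) :
    ((1 : Matrix α α ℝ).submatrix f id).rank = Fintype.card ι := by
  refine LinearIndependent.rank_matrix ?_
  have h := (Pi.linearIndependent_single_one α ℝ).comp f hf
  have hrow : ((1 : Matrix α α ℝ).submatrix f id).row =
      (fun i : α => (Pi.single i 1 : α → ℝ)) ∘ f := by
    ext i a
    simp [Matrix.row, Matrix.one_apply, Pi.single_apply, eq_comm]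
  rw [hrow]
  exact h

/-- In a hypergraph where every vertex set `V'` induces at most `k * |V'|` hyperedges, the
hyperedges can be assigned injectively to pairs of an endpoint and one of `k` colours. -/
theorem exists_injective_mem_ends {V E : Type*} [DecidableEq V] [Fintype E] (k : ℕ)
    (ends : E → Finset V)
    (h : ∀ V' : Finset V, (Finset.univ.filter fun e => ends e ⊆ V').card ≤ k * V'.card) :
    ∃ f : E → V × Fin k, Function.Injective f ∧ ∀ e, (f e).1 ∈ ends e := by
  classical
  obtain ⟨f, hf, hmem⟩ := (Finset.all_card_le_biUnion_card_iff_exists_injective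
    fun e => ends e ×ˢ (Finset.univ : Finset (Fin k))).mp fun A => by
      have hprod : (A.biUnion fun e => ends e ×ˢ (Finset.univ : Finset (Fin k))) =
          A.biUnion ends ×ˢ Finset.univ := by
        ext ⟨v, j⟩
        simp
      rw [hprod, Finset.card_product, Finset.card_fin, mul_comm]
      refine le_trans (Finset.card_le_card fun e he => ?_) (h (A.biUnion ends))
      simpa using Finset.subset_biUnion_of_mem ends he
  exact ⟨f, hf, fun e => (Finset.mem_product.mp (hmem e)).1⟩


/-- Let `(k, ℓ, d)` be matroidal sparsity parameters and let `G` be a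
`(k, ℓ)`-tight `d`-uniform hypergraph on `n` vertices (so `G` has `m = k*n - ℓ`
hyperedges).  Then there exist a natural matrix `M` for `G` and a real `(k*n) × ℓ`
matrix `U` of rank `ℓ` such that `M * U = 0` and `rank M = k*n - ℓ`. -/
theorem tight_exists_natural_matrix (k ℓ d n m : ℕ) (hparam : ℓ < d * k)
    (ends : Fin m → Finset (Fin n)) (hunif : ∀ e, (ends e).card = d)
    (hsparse : ∀ V' : Finset (Fin n),
      (Finset.univ.filter fun e => ends e ⊆ V').card ≤ k * V'.card - ℓ)
    (htight : m + ℓ = k * n) :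
    ∃ M : Matrix (Fin m) (Fin n × Fin k) ℝ, ∃ U : Matrix (Fin n × Fin k) (Fin ℓ) ℝ,
      (∀ e v j, v ∉ ends e → M e (v, j) = 0) ∧
      U.rank = ℓ ∧ M * U = 0 ∧ M.rank = k * n - ℓ := by
  obtain ⟨f, hf, hmem⟩ := exists_injective_mem_ends k ends fun V' =>
    (hsparse V').trans (Nat.sub_le _ _)
  have hcard : Fintype.card {p // p ∉ Set.range f} = ℓ := by
    rw [Fintype.card_subtype_compl, Set.card_range_of_injective hf]
    simp only [Fintype.card_prod, Fintype.card_fin]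
    rw [mul_comm n k]
    omega
  let g : Fin ℓ ≃ {p // p ∉ Set.range f} := (Fintype.equivFinOfCardEq hcard).symm
  refine ⟨(1 : Matrix _ _ ℝ).submatrix f id,
    ((1 : Matrix _ _ ℝ).submatrix (Subtype.val ∘ g) id).transpose, ?_, ?_, ?_, ?_⟩
  · intro e v j hv
    rw [Matrix.submatrix_apply, Matrix.one_apply_ne]
    rintro h
    exact hv (by simpa [h] using hmem e)
  · rw [Matrix.rank_transpose, Matrix.rank_one_submatrix_of_injective
      (Subtype.val_injective.comp g.injective), Fintype.card_fin]
  · ext e i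
    have h : f e ≠ g i := fun h => (g i).2 ⟨e, h⟩
    simp [Matrix.mul_apply, Matrix.one_apply, h]
  · rw [Matrix.rank_one_submatrix_of_injective hf, Fintype.card_fin]
    omega
end

section
/- Let (k,ℓ,d) be matroidal sparsity parameters, let G be a (k,ℓ)-tight d-uniform hypergraph on n vertices, and let M be a natural matrix for G of rank k·n − ℓ, with row m_e ∈ ℝ^{kn} for each hyperedge e. For a vertex subset V', let π_{V'} denote the projection of ℝ^{kn} onto the k·|V'| coordinates belonging to the column blocks of V', let W_{V'} = π_{V'}(span{m_e : e induced by V'}), and for a subspace U ⊆ ℝ^{kn} let U_{V'} = π_{V'}(U). Then there exists an ℓ-dimensional subspace U ⊆ ℝ^{kn} such that for every vertex subset V' ⊆ V, W_{V'} ∩ U_{V'} = {0}. -/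
/-- The projection of `ℝ^{kn}` onto the `k*|V'|` coordinates belonging to the column
blocks of the vertices of `V'`. -/
noncomputable def blockProj (n k : ℕ) (V' : Finset (Fin n)) :
    ((Fin n × Fin k) → ℝ) →ₗ[ℝ] ({p : Fin n × Fin k // p.1 ∈ V'} → ℝ) :=
  LinearMap.funLeft ℝ ℝ (fun p : {p : Fin n × Fin k // p.1 ∈ V'} => (p : Fin n × Fin k))

/-- Finitely many subspaces of codimension at least `r` over an infinite field admit a common
disjoint subspace of dimension `r`. -/
theorem Submodule.exists_finrank_eq_forall_disjoint {K E ι : Type*} [Field K] [Infinite K]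
    [AddCommGroup E] [Module K E] [FiniteDimensional K E] [Finite ι] [Nonempty ι]
    (X : ι → Submodule K E) (r : ℕ)
    (hX : ∀ i, Module.finrank K (X i) + r ≤ Module.finrank K E) :
    ∃ U : Submodule K E, Module.finrank K U = r ∧ ∀ i, Disjoint (X i) U := by
  induction r with
  | zero => exact ⟨⊥, finrank_bot K E, fun i => disjoint_bot_right⟩
  | succ r ih =>
    obtain ⟨U, hU, hdisj⟩ := ih fun i => by have := hX i; omega
    have hproper : ∀ i, X i ⊔ U ≠ ⊤ := fun i htop => by
      have h₁ := Submodule.finrank_add_le_finrank_add_finrank (X i) U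
      have h₂ := hX i
      rw [htop, finrank_top] at h₁
      omega
    obtain ⟨v, hv⟩ : ∃ v, ∀ i, v ∉ X i ⊔ U := by
      by_contra! h
      obtain ⟨i, hi⟩ := Subspace.exists_eq_top_of_iUnion_eq_univ (p := fun i => X i ⊔ U)
        (Set.eq_univ_of_forall fun v => Set.mem_iUnion.2 (h v))
      exact hproper i hi
    have hvU : v ∉ U := fun h => hv (Classical.arbitrary ι) (Submodule.mem_sup_right h)
    have hv0 : v ≠ 0 := fun h => hvU (h ▸ U.zero_mem)
    refine ⟨U ⊔ K ∙ v, ?_, fun i => ?_⟩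
    · have h := Submodule.finrank_sup_add_finrank_inf_eq U (K ∙ v)
      rw [((Submodule.disjoint_span_singleton' hv0).2 hvU).eq_bot, finrank_bot,
        finrank_span_singleton hv0, hU] at h
      exact h
    · exact (hdisj i).disjoint_sup_right_of_disjoint_sup_left
        ((Submodule.disjoint_span_singleton' hv0).2 (hv i))

theorem blockProj_surjective (n k : ℕ) (V' : Finset (Fin n)) :
    Function.Surjective (blockProj n k V') :=
  LinearMap.funLeft_surjective_of_injective ℝ ℝ _ Subtype.val_injective

theorem finrank_ker_blockProj (n k : ℕ) (V' : Finset (Fin n)) :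
    k * V'.card + Module.finrank ℝ (LinearMap.ker (blockProj n k V')) = k * n := by
  have hcard : Fintype.card {p : Fin n × Fin k // p.1 ∈ V'} = k * V'.card := by
    rw [Fintype.card_subtype, show (Finset.univ.filter fun p : Fin n × Fin k => p.1 ∈ V') =
      V' ×ˢ Finset.univ by ext; simp, Finset.card_product, Finset.card_fin, mul_comm]
  have h := (blockProj n k V').finrank_range_add_finrank_ker
  rw [LinearMap.range_eq_top.2 (blockProj_surjective n k V'), finrank_top, Module.finrank_pi,
    Module.finrank_pi, hcard] at h
  rw [h, Fintype.card_prod, Fintype.card_fin, Fintype.card_fin, mul_comm]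


/-- Let `(k, ℓ, d)` be matroidal sparsity parameters, `G` a `(k, ℓ)`-tight
`d`-uniform hypergraph on `n` vertices, and `M` a natural matrix for `G` of rank
`k*n - ℓ`, with row `M e` for each hyperedge `e`.  With `W_{V'}` the projection onto the
blocks of `V'` of the span of the rows of edges induced by `V'`, and `U_{V'}` the
projection of a subspace `U`, there exists an `ℓ`-dimensional subspace `U ⊆ ℝ^{kn}` such
that `W_{V'} ∩ U_{V'} = {0}` for every vertex subset `V'`. -/
theorem exists_transversal_subspace (k ℓ d n m : ℕ) (hparam : ℓ < d * k)
    (ends : Fin m → Finset (Fin n)) (hunif : ∀ e, (ends e).card = d)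
    (hsparse : ∀ V' : Finset (Fin n),
      (Finset.univ.filter fun e => ends e ⊆ V').card ≤ k * V'.card - ℓ)
    (htight : m + ℓ = k * n)
    (M : Matrix (Fin m) (Fin n × Fin k) ℝ)
    (hnat : ∀ e v j, v ∉ ends e → M e (v, j) = 0)
    (hrank : M.rank = k * n - ℓ) :
    ∃ U : Submodule ℝ ((Fin n × Fin k) → ℝ), Module.finrank ℝ U = ℓ ∧
      ∀ V' : Finset (Fin n),
        (Submodule.span ℝ ((fun e => M e) '' {e | ends e ⊆ V'})).map (blockProj n k V') ⊓
          U.map (blockProj n k V') = ⊥ := by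
  classical
  have hspan : ∀ V' : Finset (Fin n), Module.finrank ℝ
      (Submodule.span ℝ ((fun e => M e) '' {e | ends e ⊆ V'})) ≤ k * V'.card - ℓ := fun V' => by
    refine le_trans ?_ (hsparse V')
    have h := finrank_span_finset_le_card (R := ℝ)
      ((Finset.univ.filter fun e => ends e ⊆ V').image fun e => M e)
    rw [Set.finrank, Finset.coe_image, Finset.coe_filter_univ] at h
    exact h.trans Finset.card_image_le
  have : Nonempty {V' : Finset (Fin n) // ℓ ≤ k * V'.card} :=
    ⟨Finset.univ, by rw [Finset.card_fin]; omega⟩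
  obtain ⟨U, hU, hdisj⟩ := Submodule.exists_finrank_eq_forall_disjoint
    (fun V' : {V' : Finset (Fin n) // ℓ ≤ k * V'.card} =>
      Submodule.span ℝ ((fun e => M e) '' {e | ends e ⊆ V'.1}) ⊔
        LinearMap.ker (blockProj n k V'.1)) ℓ (fun V' => by
      have h₁ := hspan V'.1
      have h₂ := finrank_ker_blockProj n k V'.1
      have h₃ := V'.2
      refine (Nat.add_le_add_right
        (Submodule.finrank_add_le_finrank_add_finrank _ _) ℓ).trans ?_
      rw [Module.finrank_pi, Fintype.card_prod, Fintype.card_fin, Fintype.card_fin, mul_comm n k]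
      omega)
  refine ⟨U, hU, fun V' => ?_⟩
  by_cases hV' : ℓ ≤ k * V'.card
  · have h := hdisj ⟨V', hV'⟩
    rw [← Submodule.comap_map_eq] at h
    rw [eq_bot_iff]
    rintro _ ⟨hw, u, hu, rfl⟩
    rw [Submodule.disjoint_def.1 h u hw hu, map_zero]
    exact Submodule.zero_mem _
  · have h := hspan V'
    rw [Nat.sub_eq_zero_of_le (le_of_not_ge hV'), Nat.le_zero, Submodule.finrank_eq_zero] at h
    rw [h, Submodule.map_bot, bot_inf_eq]
end

section
/- Fix integers k ≥ 1 and ℓ ≥ 0, and let d be the least integer with ℓ ≤ d·k − 1. Let K be the hypergraph on n vertices that contains, for each i ≥ d, each i-element subset of the vertices as a hyperedge with multiplicity i·k − ℓ. Then, for sufficiently large n, there exists a real matrix M with one row for each hyperedge of K and k·n columns (k columns per vertex), such that in each row the only nonzero entries lie in the column blocks of the endpoints of the corresponding hyperedge, rank(M) = k·n − ℓ, and for every sub-multiset S of hyperedges with |S| = k·n − ℓ, the rows of M indexed by S are linearly independent if and only if the hypergraph (V,S) is (k,ℓ)-tight. -/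
/-- The hyperedge type of the complete non-uniform hypergraph on `n` vertices containing,
for each `i ≥ d`, each `i`-element vertex subset as a hyperedge with multiplicity
`i*k - ℓ`. -/
def CompleteNonUniformEdge (n d k ℓ : ℕ) : Type :=
  Σ s : {s : Finset (Fin n) // d ≤ s.card}, Fin (s.1.card * k - ℓ)

open Matrix in
/-- The Gram determinant of the rows of a matrix. -/
def Matrix.gramDet {ι C R : Type*} [Fintype ι] [DecidableEq ι] [Fintype C] [CommRing R]
    (A : Matrix ι C R) : R :=
  (A * Aᵀ).det

/-- The matrix obtained by setting to zero, in each row `i`, the entries outside `T i`. -/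
def Matrix.mask {ι C R : Type*} [DecidableEq C] [Zero R] (T : ι → Finset C) (A : Matrix ι C R) :
    Matrix ι C R :=
  Matrix.of fun i c => if c ∈ T i then A i c else 0

open Matrix in
/-- A polynomial multiple of the orthogonal projection of `u` to the kernel of `B`. -/
def Matrix.kerProj {L C R : Type*} [Fintype L] [DecidableEq L] [Fintype C] [CommRing R]
    (B : Matrix L C R) (u : C → R) : C → R :=
  B.gramDet • u - ((B * Bᵀ).adjugate *ᵥ (B *ᵥ u)) ᵥ* B

namespace Matrix

section CommRing

variable {ι L C R R' : Type*} [Fintype ι] [DecidableEq ι] [Fintype L] [DecidableEq L]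
  [Fintype C] [CommRing R] [CommRing R']

theorem gramDet_map (φ : R →+* R') (A : Matrix ι C R) : (A.map φ).gramDet = φ A.gramDet := by
  simp only [gramDet]
  rw [RingHom.map_det, RingHom.mapMatrix_apply, Matrix.map_mul, transpose_map]

omit [Fintype ι] [DecidableEq ι] [Fintype C] in
theorem map_mask [DecidableEq C] (φ : R →+* R') (T : ι → Finset C) (A : Matrix ι C R) :
    (A.mask T).map φ = (A.map φ).mask T := by
  ext i c
  simp only [mask, map_apply, of_apply]
  split_ifs <;> simp

theorem kerProj_map (φ : R →+* R') (B : Matrix L C R) (u : C → R) :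
    (B.map φ).kerProj (φ ∘ u) = φ ∘ B.kerProj u := by
  have hG : (B.map φ * (B.map φ)ᵀ).adjugate = (B * Bᵀ).adjugate.map φ := by
    rw [← RingHom.mapMatrix_apply φ (B * Bᵀ).adjugate, RingHom.map_adjugate,
      RingHom.mapMatrix_apply, Matrix.map_mul, transpose_map]
  have h₁ : B.map φ *ᵥ (φ ∘ u) = φ ∘ (B *ᵥ u) := by
    ext i
    exact (RingHom.map_mulVec φ B u i).symm
  have h₂ : (B * Bᵀ).adjugate.map φ *ᵥ (φ ∘ (B *ᵥ u)) = φ ∘ ((B * Bᵀ).adjugate *ᵥ (B *ᵥ u)) := by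
    ext i
    exact (RingHom.map_mulVec φ _ _ i).symm
  ext c
  simp only [kerProj, gramDet_map, hG, h₁, h₂, Pi.sub_apply, Pi.smul_apply, smul_eq_mul,
    Function.comp_apply, map_sub, map_mul, RingHom.map_vecMul]

theorem mulVec_kerProj (B : Matrix L C R) (u : C → R) : B *ᵥ B.kerProj u = 0 := by
  rw [kerProj, mulVec_sub, mulVec_smul, ← mulVec_transpose B, mulVec_mulVec, mulVec_mulVec,
    mul_adjugate, smul_mulVec, one_mulVec, gramDet, sub_self]

theorem kerProj_of_mulVec_eq_zero {B : Matrix L C R} {u : C → R} (h : B *ᵥ u = 0) :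
    B.kerProj u = B.gramDet • u := by
  simp [kerProj, h]

theorem kerProj_apply_eq_zero {B : Matrix L C R} {u : C → R} {c : C} (hB : ∀ i, B i c = 0)
    (hu : u c = 0) : B.kerProj u c = 0 := by
  simp [kerProj, vecMul, dotProduct, hB, hu]

omit [Fintype ι] [DecidableEq ι] in
theorem mulVec_mask [DecidableEq C] (T : ι → Finset C) (A : Matrix ι C R) {u : C → R}
    (hu : ∀ i, ∀ c ∉ T i, u c = 0) : A.mask T *ᵥ u = A *ᵥ u := by
  ext i
  refine Finset.sum_congr rfl fun c _ => ?_
  by_cases hc : c ∈ T i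
  · simp [mask, hc]
  · simp [hu i c hc]

/-- Row `e` is the scaled projection of the `T e`-part of `Y e` to the vectors supported in `T e`
that lie in the kernel of `A`. -/
def kernelRows {E : Type*} [DecidableEq C] (T : E → Finset C) (A : Matrix L C R)
    (Y : Matrix E C R) : Matrix E C R :=
  of fun e => (A.mask fun _ => T e).kerProj (Y.mask T e)

theorem kernelRows_map {E : Type*} [DecidableEq C] (φ : R →+* R') (T : E → Finset C)
    (A : Matrix L C R) (Y : Matrix E C R) :
    (kernelRows T A Y).map φ = kernelRows T (A.map φ) (Y.map φ) := by
  ext e c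
  change φ ((A.mask fun _ => T e).kerProj (Y.mask T e) c) =
    ((A.map φ).mask fun _ => T e).kerProj ((Y.map φ).mask T e) c
  rw [← map_mask, ← map_mask]
  exact (congrFun (kerProj_map φ _ _) c).symm

theorem kernelRows_apply_eq_zero {E : Type*} [DecidableEq C] {T : E → Finset C}
    (A : Matrix L C R) (Y : Matrix E C R) {e : E} {c : C} (hc : c ∉ T e) :
    kernelRows T A Y e c = 0 :=
  kerProj_apply_eq_zero (by simp [mask, hc]) (by simp [mask, hc])

theorem mulVec_kernelRows {E : Type*} [DecidableEq C] (T : E → Finset C)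
    (A : Matrix L C R) (Y : Matrix E C R) (e : E) : A *ᵥ kernelRows T A Y e = 0 := by
  rw [← mulVec_mask (fun _ => T e) A fun _ c hc => kernelRows_apply_eq_zero A Y hc]
  exact mulVec_kerProj _ _

theorem kernelRows_of_mulVec_eq_zero {E : Type*} [DecidableEq C] {T : E → Finset C}
    {A : Matrix L C R} {Y : Matrix E C R} {e : E} (hY : ∀ c ∉ T e, Y e c = 0)
    (h : A *ᵥ Y e = 0) :
    kernelRows T A Y e = (A.mask fun _ => T e).gramDet • Y e := by
  have hmask : Y.mask T e = Y e := by
    ext c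
    simp only [mask, of_apply, ite_eq_left_iff]
    exact fun hc => (hY c hc).symm
  change (A.mask fun _ => T e).kerProj (Y.mask T e) = _
  rw [hmask]
  exact kerProj_of_mulVec_eq_zero (by rwa [mulVec_mask _ _ fun _ => hY])

end CommRing

section Real

variable {ι L C : Type*} [Fintype ι] [DecidableEq ι] [Fintype L] [DecidableEq L] [Fintype C]

theorem gramDet_ne_zero_iff {A : Matrix ι C ℝ} : A.gramDet ≠ 0 ↔ LinearIndependent ℝ A.row := by
  constructor
  · intro h
    rw [linearIndependent_iff_card_eq_finrank_span, Set.finrank, ← rank_eq_finrank_span_row,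
      ← rank_self_mul_transpose, rank_of_det_ne_zero h]
  · intro h
    rw [gramDet, ← isUnit_iff_ne_zero, ← isUnit_iff_isUnit_det, ← linearIndependent_rows_iff_isUnit,
      linearIndependent_iff_card_eq_finrank_span, Set.finrank, ← rank_eq_finrank_span_row,
      rank_self_mul_transpose, h.rank_matrix]

theorem exists_gramDet_mask_ne_zero [DecidableEq C] {T : ι → Finset C} {f : ι → C}
    (hf : Function.Injective f) (hT : ∀ i, f i ∈ T i) :
    ∃ A : Matrix ι C ℝ, (A.mask T).gramDet ≠ 0 := by
  refine ⟨of fun i c => if c = f i then 1 else 0, ?_⟩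
  have h : ((of fun i c => if c = f i then 1 else 0 : Matrix ι C ℝ).mask T) =
      of fun i c => if c = f i then 1 else 0 := by
    ext i c
    simp only [mask, of_apply]
    split_ifs with h₁ h₂ <;> simp_all
  have h' : (of fun i c => if c = f i then 1 else 0 : Matrix ι C ℝ) *
      (of fun i c => if c = f i then 1 else 0 : Matrix ι C ℝ)ᵀ = 1 := by
    ext i j
    simp [mul_apply, one_apply, hf.eq_iff, eq_comm]
  rw [h, gramDet, h', det_one]
  exact one_ne_zero

omit [Fintype ι] [DecidableEq ι] [Fintype L] [DecidableEq L] in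
theorem submatrix_mul_transpose_of_support {T : Finset C} {A : Matrix L C ℝ}
    (hA : ∀ i, ∀ c ∉ T, A i c = 0) (M : Matrix ι C ℝ) :
    A.submatrix id ((↑) : T → C) * (M.submatrix id ((↑) : T → C))ᵀ = A * Mᵀ := by
  ext i j
  simp only [mul_apply, submatrix_apply, transpose_apply, id]
  rw [Finset.sum_coe_sort T fun c => A i c * M j c]
  exact Finset.sum_subset (Finset.subset_univ _) fun c _ hc => by simp [hA i c hc]

/-- Orthogonality of the two matrices bounds the total number of their independent rows by the
size of a common support. -/
theorem card_add_card_le_of_mul_transpose_eq_zero {A : Matrix L C ℝ} {M : Matrix ι C ℝ}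
    {T : Finset C} (hA : LinearIndependent ℝ A.row) (hM : LinearIndependent ℝ M.row)
    (hMT : ∀ i, ∀ c ∉ T, M i c = 0) (hAT : ∀ i, ∀ c ∉ T, A i c = 0) (h : A * Mᵀ = 0) :
    Fintype.card L + Fintype.card ι ≤ T.card := by
  have hA' : LinearIndependent ℝ (A.submatrix id ((↑) : T → C)).row := by
    rw [← gramDet_ne_zero_iff, gramDet, submatrix_mul_transpose_of_support hAT]
    exact gramDet_ne_zero_iff.2 hA
  have hM' : LinearIndependent ℝ (M.submatrix id ((↑) : T → C)).row := by
    rw [← gramDet_ne_zero_iff, gramDet, submatrix_mul_transpose_of_support hMT]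
    exact gramDet_ne_zero_iff.2 hM
  have key := rank_add_rank_le_card_of_mul_eq_zero 
    ((submatrix_mul_transpose_of_support hAT M).trans h)
  rwa [rank_transpose, hA'.rank_matrix, hM'.rank_matrix, Fintype.card_coe] at key

omit [Fintype ι] [DecidableEq ι] in
theorem card_add_card_le_of_mulVec_eq_zero [DecidableEq C] {A : Matrix L C ℝ} {M : Matrix ι C ℝ}
    {T : Finset C} {S F : Finset ι} (hA : LinearIndependent ℝ (A.mask fun _ => T).row)
    (hM : LinearIndependent ℝ (fun e : {x // x ∈ S} => M e.1)) (hFS : F ⊆ S)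
    (hMT : ∀ e ∈ F, ∀ c ∉ T, M e c = 0) (h : ∀ e ∈ F, A *ᵥ M e = 0) :
    Fintype.card L + F.card ≤ T.card := by
  classical
  have hF : LinearIndependent ℝ (M.submatrix ((↑) : F → ι) id).row :=
    hM.comp (fun e : F => (⟨e.1, hFS e.2⟩ : {x // x ∈ S})) fun e e' he =>
      Subtype.ext (Subtype.mk.inj he)
  rw [← Fintype.card_coe F]
  refine card_add_card_le_of_mul_transpose_eq_zero hA hF (fun e => hMT e e.2)
    (fun i c hc => by simp only [mask, of_apply, if_neg hc]) ?_
  ext i e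
  have := congrFun (h e e.2) i
  rw [← mulVec_mask (fun _ => T) A fun _ => hMT e e.2] at this
  exact this

end Real

end Matrix

theorem MvPolynomial.exists_forall_eval_ne_zero {σ ι R : Type*} [CommRing R] [IsDomain R]
    [Infinite R] [Finite ι] (p : ι → MvPolynomial σ R) (h : ∀ i, ∃ x, eval x (p i) ≠ 0) :
    ∃ x, ∀ i, eval x (p i) ≠ 0 := by
  have := Fintype.ofFinite ι
  have hp : ∏ i, p i ≠ 0 := Finset.prod_ne_zero_iff.2 fun i _ hi => by
    obtain ⟨x, hx⟩ := h i
    exact hx (by simp [hi])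
  by_contra! hc
  refine hp (MvPolynomial.funext fun x => ?_)
  obtain ⟨i, hi⟩ := hc x
  simpa [map_prod] using Finset.prod_eq_zero (f := fun i => eval x (p i)) (Finset.mem_univ i) hi

namespace Matrix

open MvPolynomial in
/-- A matrix with independent rows in prescribed supports whose kernel stays independent
after restriction to each of these supports. -/
theorem exists_linearIndependent_and_kernel {S L C : Type*} [Fintype S] [DecidableEq S]
    [Nonempty S] [Fintype L] [DecidableEq L] [Fintype C] [DecidableEq C] {T : S → Finset C}
    (hcard : Fintype.card S + Fintype.card L = Fintype.card C)
    (hT : ∀ e, ∃ f : S ⊕ L → C, Function.Injective f ∧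
      ∀ i, f i ∈ Sum.elim T (fun _ => T e) i) :
    ∃ (M : Matrix S C ℝ) (A : Matrix L C ℝ), (∀ e, ∀ c ∉ T e, M e c = 0) ∧
      LinearIndependent ℝ M.row ∧ A * Mᵀ = 0 ∧
      ∀ e, LinearIndependent ℝ (A.mask fun _ => T e).row := by
  let X : Matrix (S ⊕ L) C (MvPolynomial ((S ⊕ L) × C) ℝ) := of fun i c => MvPolynomial.X (i, c)
  have hX (x : (S ⊕ L) × C → ℝ) (T' : S ⊕ L → Finset C) :
      eval x (X.mask T').gramDet = ((of fun i c => x (i, c) : Matrix _ C ℝ).mask T').gramDet := by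
    rw [← gramDet_map, map_mask]
    congr 2
    ext i c
    simp [X]
  obtain ⟨x, hx⟩ := exists_forall_eval_ne_zero
    (fun e : S => (X.mask (Sum.elim T (fun _ => T e))).gramDet) fun e => by
      obtain ⟨f, hf, hfT⟩ := hT e
      obtain ⟨A, hA⟩ := exists_gramDet_mask_ne_zero hf hfT
      exact ⟨fun p => A p.1 p.2, by rw [hX]; exact hA⟩
  simp only [hX, gramDet_ne_zero_iff] at hx
  set M : Matrix S C ℝ := mask T (of fun e c => x (Sum.inl e, c)) with hMdef
  have hM : LinearIndependent ℝ M.row :=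
    (hx (Classical.arbitrary S)).comp Sum.inl Sum.inl_injective
  have hker : Module.finrank ℝ (LinearMap.ker M.mulVecLin) = Fintype.card L := by
    have h₁ := M.mulVecLin.finrank_range_add_finrank_ker
    have h₂ := hM.rank_matrix
    rw [Matrix.rank] at h₂
    rw [Module.finrank_fintype_fun_eq_card] at h₁
    omega
  let b := (Module.finBasisOfFinrankEq ℝ (LinearMap.ker M.mulVecLin) hker).reindex
    (Fintype.equivFin L).symm
  have hb (i : L) : M *ᵥ (b i : C → ℝ) = 0 := (b i).2
  refine ⟨M, of fun i => b i, fun e c hc => by simp [hMdef, mask, hc], hM, ?_, fun e => ?_⟩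
  · ext i e
    simpa [mul_apply, mulVec, dotProduct, mul_comm] using congrFun (hb i) e
  · rw [Fintype.linearIndependent_iff]
    intro g hg
    set a : LinearMap.ker M.mulVecLin := ∑ i, g i • b i with ha
    suffices h : a = 0 from Fintype.linearIndependent_iff.1 b.linearIndependent g h
    have haT (c : C) (hc : c ∈ T e) : (a : C → ℝ) c = 0 := by
      have := congrFun hg c
      simpa [ha, mask, hc] using this
    have hNa : ((of fun i c => x (i, c) : Matrix _ C ℝ).mask (Sum.elim T fun _ => T e)) *ᵥ
        (a : C → ℝ) = 0 := by
      ext i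
      rcases i with i | i
      · exact congrFun (LinearMap.mem_ker.1 a.2) i
      · refine Finset.sum_eq_zero fun c _ => ?_
        by_cases hc : c ∈ T e
        · simp [haT c hc]
        · simp [mask, hc]
    have hrank := (hx e).rank_matrix
    have hN := LinearMap.finrank_range_add_finrank_ker
      ((of fun i c => x (i, c) : Matrix _ C ℝ).mask (Sum.elim T fun _ => T e)).mulVecLin
    rw [Matrix.rank, Fintype.card_sum, hcard] at hrank
    rw [hrank, Module.finrank_fintype_fun_eq_card] at hN
    have hbot := Submodule.finrank_eq_zero.1 (Nat.add_eq_left.1 hN)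
    have : (a : C → ℝ) ∈ (⊥ : Submodule ℝ (C → ℝ)) := hbot ▸ LinearMap.mem_ker.2 hNa
    exact Subtype.ext (by simpa using this)

open MvPolynomial in
/-- Generic vectors with prescribed supports in the kernel of a generic matrix. -/
theorem exists_generic_rows_in_kernel {E L C : Type*} [Finite E] [DecidableEq E] [Fintype L]
    [DecidableEq L] [Fintype C] [DecidableEq C] (T : E → Finset C) :
    ∃ (M : Matrix E C ℝ) (A : Matrix L C ℝ), (∀ e, ∀ c ∉ T e, M e c = 0) ∧
      (∀ e, A *ᵥ M e = 0) ∧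
      (∀ T' : Finset C, Fintype.card L ≤ T'.card →
        LinearIndependent ℝ (A.mask fun _ => T').row) ∧
      ∀ S : Finset E, S.Nonempty → S.card + Fintype.card L = Fintype.card C →
        (∀ e ∈ S, ∃ f : S ⊕ L → C, Function.Injective f ∧
          ∀ i, f i ∈ Sum.elim (fun e' : S => T e') (fun _ => T e) i) →
        LinearIndependent ℝ (fun e : {x // x ∈ S} => M e.1) := by
  let A : Matrix L C (MvPolynomial ((L × C) ⊕ (E × C)) ℝ) := of fun i c => X (Sum.inl (i, c))
  let Y : Matrix E C (MvPolynomial ((L × C) ⊕ (E × C)) ℝ) := of fun e c => X (Sum.inr (e, c))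
  have hA (x : (L × C) ⊕ (E × C) → ℝ) :
      A.map (eval x) = of fun i c => x (Sum.inl (i, c)) := by
    ext i c
    simp [A]
  have hY (x : (L × C) ⊕ (E × C) → ℝ) :
      Y.map (eval x) = of fun e c => x (Sum.inr (e, c)) := by
    ext i c
    simp [Y]
  let good (S : Finset E) : Prop := S.Nonempty ∧ S.card + Fintype.card L = Fintype.card C ∧
    ∀ e ∈ S, ∃ f : S ⊕ L → C, Function.Injective f ∧
      ∀ i, f i ∈ Sum.elim (fun e' : S => T e') (fun _ => T e) i
  let p : {T' : Finset C // Fintype.card L ≤ T'.card} ⊕ {S : Finset E // good S} →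
      MvPolynomial ((L × C) ⊕ (E × C)) ℝ :=
    Sum.elim (fun T' => (A.mask fun _ => T'.1).gramDet)
      fun S => ((kernelRows T A Y).submatrix ((↑) : S.1 → E) id).gramDet
  have hp (x) (T') : eval x (p (Sum.inl T')) =
      ((of fun i c => x (Sum.inl (i, c)) : Matrix L C ℝ).mask fun _ => T'.1).gramDet := by
    simp only [p, Sum.elim_inl]
    rw [← gramDet_map, map_mask, hA]
  have hp' (x) (S) : eval x (p (Sum.inr S)) = ((kernelRows T
      (of fun i c => x (Sum.inl (i, c)) : Matrix L C ℝ)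
      (of fun e c => x (Sum.inr (e, c)))).submatrix ((↑) : S.1 → E) id).gramDet := by
    simp only [p, Sum.elim_inr]
    rw [← gramDet_map, ← submatrix_map, kernelRows_map, hA, hY]
  obtain ⟨x, hx⟩ := exists_forall_eval_ne_zero p <| by
    rintro (⟨T', hT'⟩ | ⟨S, hS, hcard, hT⟩)
    · obtain ⟨f⟩ : Nonempty (L ↪ T') :=
        Function.Embedding.nonempty_of_card_le (by rwa [Fintype.card_coe])
      obtain ⟨A', hA'⟩ := exists_gramDet_mask_ne_zero (T := fun _ : L => T')
        (Subtype.val_injective.comp f.injective) fun i => (f i).2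
      exact ⟨Sum.elim (fun q => A' q.1 q.2) 0, by rw [hp]; exact hA'⟩
    · have := hS.to_subtype
      obtain ⟨M', A', hM'T, hM', hAM, hA'⟩ := exists_linearIndependent_and_kernel
        (T := fun e : S => T e) (by rwa [Fintype.card_coe]) fun e => hT e e.2
      refine ⟨Sum.elim (fun q => A' q.1 q.2)
        (fun q => if h : q.1 ∈ S then M' ⟨q.1, h⟩ q.2 else 0), ?_⟩
      rw [hp', gramDet_ne_zero_iff]
      convert! hM'.units_smul fun e => Units.mk0 _ (gramDet_ne_zero_iff.2 (hA' e)) using 1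
      ext e : 1
      have hrow : (of fun e c => if h : e ∈ S then M' ⟨e, h⟩ c else 0 : Matrix E C ℝ) e = M' e := by
        ext c
        simp
      have := kernelRows_of_mulVec_eq_zero (T := T) (A := A') (e := e.1)
        (Y := of fun e c => if h : e ∈ S then M' ⟨e, h⟩ c else 0)
        (by rw [hrow]; exact hM'T e) (by
          rw [hrow]
          ext i
          exact congrFun (congrFun hAM i) e)
      rw [hrow] at this
      exact this
  refine ⟨kernelRows T (of fun i c => x (Sum.inl (i, c))) (of fun e c => x (Sum.inr (e, c))),
    of fun i c => x (Sum.inl (i, c)), fun e c => kernelRows_apply_eq_zero _ _,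
    mulVec_kernelRows _ _ _, fun T' hT' => ?_, fun S hS hcard hT => ?_⟩
  · rw [← gramDet_ne_zero_iff, ← hp x ⟨T', hT'⟩]
    exact hx _
  · have := hx (Sum.inr ⟨S, hS, hcard, hT⟩)
    rw [hp', gramDet_ne_zero_iff] at this
    exact this

end Matrix

namespace CompleteNonUniformEdge

variable {n d k ℓ : ℕ}

instance : Finite (CompleteNonUniformEdge n d k ℓ) :=
  inferInstanceAs (Finite (Σ s : {s : Finset (Fin n) // d ≤ s.card}, Fin (s.1.card * k - ℓ)))

/-- Adding `ℓ` copies of an edge to a sparse hypergraph preserves Hall's condition for matching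
edges to columns of their endpoints. -/
theorem exists_injective_of_sparse (hd : ℓ < d * k)
    {S : Finset (CompleteNonUniformEdge n d k ℓ)}
    (h : ∀ V' : Finset (Fin n), (S.filter fun e => e.1.1 ⊆ V').card ≤ k * V'.card - ℓ)
    (e : CompleteNonUniformEdge n d k ℓ) :
    ∃ f : S ⊕ Fin ℓ → Fin n × Fin k, Function.Injective f ∧
      ∀ i, f i ∈ Sum.elim (fun e' : S => e'.1.1.1 ×ˢ (Finset.univ : Finset (Fin k)))
        (fun _ => e.1.1 ×ˢ Finset.univ) i := by
  classical
  rw [← Finset.all_card_le_biUnion_card_iff_exists_injective]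
  intro s
  set V' : Finset (Fin n) :=
    s.biUnion (Sum.elim (fun e' : S => e'.1.1.1) fun _ => e.1.1) with hV'
  have hunion : s.biUnion (Sum.elim (fun e' : S => e'.1.1.1 ×ˢ (Finset.univ : Finset (Fin k)))
      (fun _ => e.1.1 ×ˢ Finset.univ)) = V' ×ˢ Finset.univ := by
    ext ⟨v, j⟩
    simp [hV']
  have hleft : s.toLeft.card ≤ k * V'.card - ℓ := by
    refine le_trans ?_ (h V')
    rw [← Finset.card_map (Function.Embedding.subtype _)]
    refine Finset.card_le_card fun e' he' => ?_
    obtain ⟨e', hs, rfl⟩ := Finset.mem_map.1 he'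
    exact Finset.mem_filter.2 ⟨e'.2, Finset.subset_biUnion_of_mem
      (Sum.elim (fun e' : S => e'.1.1.1) fun _ => e.1.1) (Finset.mem_toLeft.1 hs)⟩
  rw [hunion, Finset.card_product, Finset.card_univ, Fintype.card_fin, mul_comm,
    ← Finset.card_toLeft_add_card_toRight]
  rcases s.toRight.eq_empty_or_nonempty with hs | ⟨i, hi⟩
  · rw [hs, Finset.card_empty]
    omega
  · have he : d ≤ V'.card := e.1.2.trans <| Finset.card_le_card <|
      Finset.subset_biUnion_of_mem (Sum.elim (fun e' : S => e'.1.1.1) fun _ => e.1.1)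
        (Finset.mem_toRight.1 hi)
    have hdk : d * k ≤ k * V'.card := by
      rw [mul_comm]
      exact Nat.mul_le_mul_left k he
    have hright : s.toRight.card ≤ ℓ := by simpa using s.toRight.card_le_univ
    omega

/-- All copies of the full vertex set form a sparse hypergraph. -/
theorem exists_sparse (hn : d ≤ n) : ∃ S : Finset (CompleteNonUniformEdge n d k ℓ),
    S.card = k * n - ℓ ∧ ∀ V' : Finset (Fin n),
      (S.filter fun e => e.1.1 ⊆ V').card ≤ k * V'.card - ℓ := by
  let s : {s : Finset (Fin n) // d ≤ s.card} := ⟨Finset.univ, by simpa using hn⟩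
  let S : Finset (CompleteNonUniformEdge n d k ℓ) :=
    Finset.univ.map (Function.Embedding.sigmaMk (β := fun s : {s : Finset (Fin n) // d ≤ s.card} =>
      Fin (s.1.card * k - ℓ)) s)
  have hS : S.card = k * n - ℓ := by
    refine (Finset.card_map _).trans ?_
    rw [Finset.card_univ, Fintype.card_fin, Finset.card_univ, Fintype.card_fin, mul_comm]
  refine ⟨S, hS, fun V' => ?_⟩
  by_cases hV' : V' = Finset.univ
  · rw [hV', Finset.card_univ, Fintype.card_fin, ← hS]
    exact Finset.card_filter_le _ _
  · rw [Finset.filter_false_of_mem, Finset.card_empty]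
    · exact Nat.zero_le _
    · intro e he
      obtain ⟨i, -, rfl⟩ := Finset.mem_map.1 he
      exact fun h => hV' (Finset.univ_subset_iff.1 h)

end CompleteNonUniformEdge

/-- Natural Realizations, non-uniform version: Fix `k ≥ 1`, `ℓ ≥ 0`, and
let `d` be the least integer with `ℓ ≤ d*k - 1`.  For sufficiently large `n` there is a
real matrix `M` with one row per hyperedge of the complete non-uniform hypergraph
(`i`-element subsets with multiplicity `i*k - ℓ` for `i ≥ d`), `k` columns per vertex,
zero entries outside the endpoint column blocks in each row, `rank M = k*n - ℓ`, and for
every sub-multiset `S` of hyperedges with `|S| = k*n - ℓ`, the rows indexed by `S` are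
linearly independent iff `(V, S)` is `(k, ℓ)`-tight. -/
theorem natural_realization_nonuniform (k ℓ d : ℕ) (hk : 1 ≤ k)
    (hd : ℓ < d * k) (hdmin : ∀ d' : ℕ, ℓ < d' * k → d ≤ d') :
    ∃ N : ℕ, ∀ n : ℕ, N ≤ n →
      ∃ M : Matrix (CompleteNonUniformEdge n d k ℓ) (Fin n × Fin k) ℝ,
        (∀ e v j, v ∉ e.1.1 → M e (v, j) = 0) ∧
        M.rank = k * n - ℓ ∧
        ∀ S : Finset (CompleteNonUniformEdge n d k ℓ),
          S.card = k * n - ℓ →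
          (LinearIndependent ℝ (fun e : {x // x ∈ S} => M e.1) ↔
            ((∀ V' : Finset (Fin n),
                (S.filter fun e => e.1.1 ⊆ V').card ≤ k * V'.card - ℓ) ∧
              S.card + ℓ = k * n)) := by
  refine ⟨d, fun n hn => ?_⟩
  classical
  have hkn : ℓ < k * n := hd.trans_le (by rw [mul_comm]; exact Nat.mul_le_mul_left k hn)
  obtain ⟨M, A, hMT, hAM, hA, hM⟩ := Matrix.exists_generic_rows_in_kernel (L := Fin ℓ)
    (fun e : CompleteNonUniformEdge n d k ℓ => e.1.1 ×ˢ (Finset.univ : Finset (Fin k)))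
  have card_prod (V' : Finset (Fin n)) :
      (V' ×ˢ (Finset.univ : Finset (Fin k))).card = k * V'.card := by
    rw [Finset.card_product, Finset.card_univ, Fintype.card_fin, mul_comm]
  have hsparse (S : Finset (CompleteNonUniformEdge n d k ℓ)) (hS : S.card = k * n - ℓ)
      (h : ∀ V' : Finset (Fin n),
        (S.filter fun e => e.1.1 ⊆ V').card ≤ k * V'.card - ℓ) :
      LinearIndependent ℝ (fun e : {x // x ∈ S} => M e.1) := by
    refine hM S (Finset.card_pos.1 (by omega)) ?_ fun e _ =>
      CompleteNonUniformEdge.exists_injective_of_sparse hd h e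
    rw [hS, Fintype.card_fin, Fintype.card_prod, Fintype.card_fin, Fintype.card_fin, mul_comm n k]
    omega
  have hM0 (e : CompleteNonUniformEdge n d k ℓ) (v j) (hv : v ∉ e.1.1) : M e (v, j) = 0 :=
    hMT e _ fun h => hv (Finset.mem_product.1 h).1
  refine ⟨M, hM0, le_antisymm ?_ ?_, fun S hS => ⟨fun hli => ⟨fun V' => ?_, by omega⟩,
    fun h => hsparse S hS h.1⟩⟩
  · have hArank : A.rank = ℓ := by
      have h := (hA Finset.univ (by simpa [mul_comm n k] using hkn.le)).rank_matrix
      have hmask : (A.mask fun _ => Finset.univ) = A := by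
        ext i c
        simp [Matrix.mask]
      rwa [hmask, Fintype.card_fin] at h
    have := Fintype.ofFinite (CompleteNonUniformEdge n d k ℓ)
    have hAM' : A * M.transpose = 0 := by
      ext i e
      exact congrFun (hAM e) i
    have h := Matrix.rank_add_rank_le_card_of_mul_eq_zero hAM'
    rw [hArank, Matrix.rank_transpose, Fintype.card_prod, Fintype.card_fin, Fintype.card_fin,
      mul_comm n k] at h
    omega
  · obtain ⟨S, hS, h⟩ := CompleteNonUniformEdge.exists_sparse (k := k) (ℓ := ℓ) hn
    have hli : LinearIndependent ℝ (M.submatrix ((↑) : S → _) id).row := hsparse S hS h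
    calc k * n - ℓ = (M.submatrix ((↑) : S → _) id).rank := by
          rw [hli.rank_matrix,
            Fintype.card_coe, hS]
      _ ≤ M.rank := by
          rw [Matrix.rank_eq_finrank_span_row, Matrix.rank_eq_finrank_span_row]
          refine Submodule.finrank_mono (Submodule.span_mono ?_)
          rintro _ ⟨e, rfl⟩
          exact ⟨e, rfl⟩
  · by_cases hV' : d ≤ V'.card
    · have hle : ℓ ≤ k * V'.card :=
        hd.le.trans (by rw [mul_comm]; exact Nat.mul_le_mul_left k hV')
      have key := Matrix.card_add_card_le_of_mulVec_eq_zero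
        (hA (V' ×ˢ Finset.univ) (by rwa [card_prod, Fintype.card_fin])) hli
        (Finset.filter_subset (fun e => e.1.1 ⊆ V') S)
        (fun e he c hc => hM0 _ _ _ fun h =>
          hc (Finset.mem_product.2 ⟨(Finset.mem_filter.1 he).2 h, Finset.mem_univ _⟩))
        fun e _ => hAM e
      rw [card_prod, Fintype.card_fin] at key
      omega
    · rw [Finset.filter_false_of_mem, Finset.card_empty]
      · exact Nat.zero_le _
      · exact fun e _ he => hV' (e.1.2.trans (Finset.card_le_card he))
end
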